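/- Let 𝔠 be an ample interrupted constellation. Then for every two anticomplete induced subgraphs X_1, X_2 of 𝔠, there exists i ∈ {1,2} such that each connected component of X_i intersects S_𝔠 in at most one vertex. -/

import Mathlib

open SimpleGraph

/-- Two vertex sets `X` and `Y` are *anticomplete* in `G` if they are disjoint and
there is no edge of `G` with an end in each. -/
def Anticomplete {V : Type} (G : SimpleGraph V) (X Y : Set V) : Prop :=
  Disjoint X Y ∧ ∀ x ∈ X, ∀ y ∈ Y, ¬ G.Adj x y

/-- `G` has an induced subgraph isomorphic to `H`. -/
def HasInducedSubgraphIso {V W : Type} (G : SimpleGraph V) (H : SimpleGraph W) : Prop :=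
  ∃ X : Set V, Nonempty (H ≃g G.induce X)

/-- `G` has an induced minor isomorphic to `H`, witnessed by branch sets. -/
def HasInducedMinor {V W : Type} (G : SimpleGraph V) (H : SimpleGraph W) : Prop :=
  ∃ B : W → Set V,
    (∀ w, (G.induce (B w)).Connected) ∧
    (Pairwise fun u v => Disjoint (B u) (B v)) ∧
    (∀ u v : W, u ≠ v → (H.Adj u v ↔ ¬ Anticomplete G (B u) (B v)))

/-- The set `P` induces a path in `G`. -/
def IsPathSet {V : Type} (G : SimpleGraph V) (P : Set V) : Prop :=
  ∃ n : ℕ, Nonempty (G.induce P ≃g pathGraph (n + 1))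

/-- The vertex sets of the connected components of the subgraph of `G` induced on `X`. -/
def CompsOn {V : Type} (G : SimpleGraph V) (X : Set V) : Set (Set V) :=
  {L | ∃ C : (G.induce X).ConnectedComponent, L = Subtype.val '' C.supp}

/-- The induced subgraph of `G` on `W` together with the stable set `S ⊆ W` forms a
constellation: every component of `W \ S` is a path and every vertex of `S` has a
neighbor in every such component. -/
structure IsConstellationOn {V : Type} (G : SimpleGraph V) (W S : Set V) : Prop where
  subset : S ⊆ W
  stable : ∀ x ∈ S, ∀ y ∈ S, ¬ G.Adj x y
  comp_paths : ∀ L ∈ CompsOn G (W \ S), IsPathSet G L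
  dominates : ∀ x ∈ S, ∀ L ∈ CompsOn G (W \ S), ∃ y ∈ L, G.Adj x y

/-- `p` is a route of the constellation `(W, S)` in `G`: an induced path of the induced
subgraph of `G` on `W`, with its two (distinct) ends in `S` and its interior outside `S`. -/
structure IsRoute {V : Type} (G : SimpleGraph V) (W S : Set V) {x y : V}
    (p : G.Walk x y) : Prop where
  ne : x ≠ y
  isPath : p.IsPath
  induced : ∀ u v, u ∈ p.support → v ∈ p.support → G.Adj u v → p.toSubgraph.Adj u v
  support_mem : ∀ v ∈ p.support, v ∈ W
  fst_mem : x ∈ S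
  snd_mem : y ∈ S
  interior : ∀ v ∈ p.support, v ≠ x → v ≠ y → v ∉ S

/-- The constellation `(W, S)` in `G` is `d`-ample: no route has length at most `d+1`. -/
def DAmple {V : Type} (G : SimpleGraph V) (W S : Set V) (d : ℕ) : Prop :=
  ∀ ⦃x y : V⦄ (p : G.Walk x y), IsRoute G W S p → d + 1 < p.length

/-- The constellation `(W, S)` in `G` is interrupted with respect to some linear order
(encoded by an injective-on-`S` function `f : V → ℕ`). -/
def Interrupted {V : Type} (G : SimpleGraph V) (W S : Set V) : Prop :=
  ∃ f : V → ℕ, Set.InjOn f S ∧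
    ∀ x ∈ S, ∀ y ∈ S, ∀ z ∈ S, f x < f y → f y < f z →
      ∀ (p : G.Walk x y), IsRoute G W S p → ∃ v ∈ p.support, G.Adj z v

/-- The constellation `(W, S)` in `G` is `q`-zigzagged. -/
def Zigzagged {V : Type} (G : SimpleGraph V) (W S : Set V) (q : ℕ) : Prop :=
  ∃ f : V → ℕ, Set.InjOn f S ∧
    ∀ x ∈ S, ∀ y ∈ S, f x < f y →
      ∀ (p : G.Walk x y), IsRoute G W S p →
        {z | z ∈ S ∧ f x < f z ∧ f z < f y ∧ ¬ ∃ v ∈ p.support, G.Adj z v}.ncard < q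

/-- The constellation `(W, S)` in `G` is `(qm, q, qp)`-mixed. -/
def Mixed {V : Type} (G : SimpleGraph V) (W S : Set V) (qm q qp : ℕ) : Prop :=
  ∃ f : V → ℕ, Set.InjOn f S ∧
    ∀ x ∈ S, ∀ y ∈ S, f x < f y →
      ∀ (p : G.Walk x y), IsRoute G W S p →
        ∀ Qm Q Qp : Set V, Qm ⊆ S → Q ⊆ S → Qp ⊆ S →
          Qm.ncard = qm → Q.ncard = q → Qp.ncard = qp →
          (∀ z ∈ Qm, f z < f x) → (∀ z ∈ Q, f x < f z ∧ f z < f y) →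
          (∀ z ∈ Qp, f y < f z) →
          ∃ z ∈ Qm ∪ Q ∪ Qp, ∃ v ∈ p.support, G.Adj z v

/-- The constellation `(W', S')` sits in the constellation `(W, S)` (both within `G`). -/
def SitsIn {V : Type} (G : SimpleGraph V) (W' S' W S : Set V) : Prop :=
  W' ⊆ W ∧ S' ⊆ S ∧
  (∀ L ∈ CompsOn G (W' \ S'), ∃ M ∈ CompsOn G (W \ S), L ⊆ M) ∧
  (∀ M ∈ CompsOn G (W \ S), ∀ L₁ ∈ CompsOn G (W' \ S'), ∀ L₂ ∈ CompsOn G (W' \ S'),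
      L₁ ⊆ M → L₂ ⊆ M → L₁ = L₂)

/-- A witness that `S` is a subdivision of `H`, where each edge of `H` is replaced by a
path whose length satisfies `ok`. -/
structure SubdivModel {U W : Type} (S : SimpleGraph U) (H : SimpleGraph W)
    (ok : ℕ → Prop) where
  b : W → U
  b_inj : Function.Injective b
  path : ∀ ⦃u v : W⦄, H.Adj u v → S.Walk (b u) (b v)
  path_isPath : ∀ ⦃u v : W⦄ (h : H.Adj u v), (path h).IsPath
  path_len : ∀ ⦃u v : W⦄ (h : H.Adj u v), ok (path h).length
  path_symm : ∀ ⦃u v : W⦄ (h : H.Adj u v), path h.symm = (path h).reverse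
  branch_avoid : ∀ ⦃u v : W⦄ (h : H.Adj u v) (w : W), b w ∈ (path h).support → w = u ∨ w = v
  interiors_anticomplete :
    ∀ ⦃u v u' v' : W⦄ (h : H.Adj u v) (h' : H.Adj u' v'),
      (s(u, v) : Sym2 W) ≠ s(u', v') →
      ∀ x ∈ (path h).support, x ≠ b u → x ≠ b v →
      ∀ y ∈ (path h').support, y ≠ b u' → y ≠ b v' →
        x ≠ y ∧ ¬ S.Adj x y
  cover : ∀ x : U, (∃ w, x = b w) ∨ ∃ (u v : W) (h : H.Adj u v), x ∈ (path h).support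
  edges_eq : ∀ x y : U, S.Adj x y → ∃ (u v : W) (h : H.Adj u v), (path h).toSubgraph.Adj x y

/-- `S` is a subdivision of `H` with path lengths satisfying `ok`. -/
def IsSubdivisionWith {U W : Type} (S : SimpleGraph U) (H : SimpleGraph W)
    (ok : ℕ → Prop) : Prop :=
  Nonempty (SubdivModel S H ok)

/-- The line graph of `G`. -/
def LineGraph {V : Type} (G : SimpleGraph V) : SimpleGraph G.edgeSet :=
  SimpleGraph.fromRel (fun e f => ∃ v : V, v ∈ (e : Sym2 V) ∧ v ∈ (f : Sym2 V))

/-- The `r`-by-`r` hexagonal wall (brick wall). -/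
def Wall (r : ℕ) : SimpleGraph (Fin r × Fin (2 * r)) :=
  SimpleGraph.fromRel (fun a b =>
    (a.1 = b.1 ∧ a.2.val + 1 = b.2.val) ∨
    (a.2 = b.2 ∧ a.1.val + 1 = b.1.val ∧ (a.1.val + a.2.val) % 2 = 0))

/-- The full binary tree of radius `r`, on `2^(r+1) - 1` vertices (heap indexing). -/
def BinTree (r : ℕ) : SimpleGraph (Fin (2 ^ (r + 1) - 1)) :=
  SimpleGraph.fromRel (fun a b =>
    b.val + 1 = 2 * (a.val + 1) ∨ b.val + 1 = 2 * (a.val + 1) + 1)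

/-- The leaf-extension of `H` by leaves `L` attached via `f`. -/
def leafExt {W : Type} (H : SimpleGraph W) (L : Type) (f : L → W) :
    SimpleGraph (W ⊕ L) :=
  SimpleGraph.fromRel (fun a b =>
    match a, b with
    | Sum.inl a, Sum.inl b => H.Adj a b
    | Sum.inl a, Sum.inr x => f x = a
    | _, _ => False)

/-- `G` has treewidth at most `k` (via tree decompositions). -/
def TreewidthLE {V : Type} (G : SimpleGraph V) (k : ℕ) : Prop :=
  ∃ (ι : Type) (T : SimpleGraph ι) (bag : ι → Set V),
    T.IsTree ∧
    (∀ v, ∃ i, v ∈ bag i) ∧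
    (∀ u v, G.Adj u v → ∃ i, u ∈ bag i ∧ v ∈ bag i) ∧
    (∀ v, (T.induce {i | v ∈ bag i}).Connected) ∧
    (∀ i, (bag i).ncard ≤ k + 1)

/-- `G` has pathwidth at most `k` (via path decompositions). -/
def PathwidthLE {V : Type} (G : SimpleGraph V) (k : ℕ) : Prop :=
  ∃ (n : ℕ) (bag : Fin n → Set V),
    (∀ v, ∃ i, v ∈ bag i) ∧
    (∀ u v, G.Adj u v → ∃ i, u ∈ bag i ∧ v ∈ bag i) ∧
    (∀ (v : V) (i j k' : Fin n), i ≤ j → j ≤ k' → v ∈ bag i → v ∈ bag k' → v ∈ bag j) ∧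
    (∀ i, (bag i).ncard ≤ k + 1)

/-- An induced `(s,t)`-model in `G`. -/
def IsInducedModel {V : Type} (G : SimpleGraph V) {s t : ℕ}
    (A : Fin s → Set V) (B : Fin t → Set V) : Prop :=
  (∀ i, (G.induce (A i)).Connected) ∧
  (∀ j, (G.induce (B j)).Connected) ∧
  (∀ i j : Fin s, i ≠ j → Anticomplete G (A i) (A j)) ∧
  (∀ i j : Fin t, i ≠ j → Anticomplete G (B i) (B j)) ∧
  (∀ (i : Fin s) (j : Fin t), Disjoint (A i) (B j) ∧ ¬ Anticomplete G (A i) (B j))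

/-- The `A`-contraction of a model: each `A i` is contracted to the vertex `Sum.inl i`. -/
def AContraction {V : Type} (G : SimpleGraph V) {s t : ℕ}
    (A : Fin s → Set V) (B : Fin t → Set V) :
    SimpleGraph (Fin s ⊕ (⋃ j, B j : Set V)) :=
  SimpleGraph.fromRel (fun x y =>
    match x, y with
    | Sum.inl i, Sum.inl i' => i ≠ i' ∧ ∃ a ∈ A i, ∃ a' ∈ A i', G.Adj a a'
    | Sum.inl i, Sum.inr b => ∃ a ∈ A i, G.Adj a ↑b
    | Sum.inr b, Sum.inr b' => G.Adj ↑b ↑b'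
    | _, _ => False)

/-- A linear induced model is `d`-`A`-ample if its `A`-contraction is `d`-ample. -/
def ModelAAmple {V : Type} (G : SimpleGraph V) {s t : ℕ}
    (A : Fin s → Set V) (B : Fin t → Set V) (d : ℕ) : Prop :=
  DAmple (AContraction G A B) Set.univ (Set.range Sum.inl) d

/-- A linear induced model is `d`-ample if it is `d`-`A`-ample and `d`-`B`-ample. -/
def ModelAmple {V : Type} (G : SimpleGraph V) {s t : ℕ}
    (A : Fin s → Set V) (B : Fin t → Set V) (d : ℕ) : Prop :=
  ModelAAmple G A B d ∧ ModelAAmple G B A d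

/-- The zigzag sequences. -/
def Zseq : ℕ → List ℤ
  | 0 => []
  | 1 => [1]
  | 2 => [1, 2]
  | 3 => [1, 2, 3]
  | n + 4 =>
      (Zseq (n + 3)).dropLast ++ (((Zseq (n + 2)).map (· + 1)).reverse).dropLast
        ++ (Zseq (n + 3)).map (· + 1)

/-- Collapse each maximal run of consecutive equal entries to a single entry. -/
def collapse (l : List ℤ) : List ℤ := l.destutter (· ≠ ·)

/-- `B` is an alignment in the sequence `A`. -/
def IsAlignment (A : List ℤ) (B : Finset ℤ) : Prop :=
  (∀ b ∈ B, b ∈ A) ∧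
  ∃ i j : ℕ, i ≤ j ∧ j < A.length ∧
    ∀ b ∈ B,
      (collapse (((A.take (j + 1)).drop i).filter (fun a => decide (a ∈ B)))).count b = 1

theorem IsRoute.reverse {V : Type} {G : SimpleGraph V} {W S : Set V} {x y : V}
    {p : G.Walk x y} (h : IsRoute G W S p) : IsRoute G W S p.reverse where
  ne := h.ne.symm
  isPath := h.isPath.reverse
  induced u v hu hv huv := by
    rw [Walk.toSubgraph_reverse]
    exact h.induced u v (by simpa using hu) (by simpa using hv) huv
  support_mem v hv := h.support_mem v (by simpa using hv)
  fst_mem := h.snd_mem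
  snd_mem := h.fst_mem
  interior v hv hy hx := h.interior v (by simpa using hv) hx hy

/-- A walk within `X` that is shortest among those joining two distinct vertices of `S`
is a route. -/
theorem isRoute_of_forall_length_le {V : Type} {G : SimpleGraph V} {X S : Set V} {x y : V}
    (p : G.Walk x y) (hxy : x ≠ y) (hx : x ∈ S) (hy : y ∈ S) (hX : ∀ v ∈ p.support, v ∈ X)
    (hmin : ∀ ⦃a b : V⦄ (q : G.Walk a b), a ≠ b → a ∈ S → b ∈ S →
      (∀ v ∈ q.support, v ∈ X) → p.length ≤ q.length) :
    IsRoute G Set.univ S p where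
  ne := hxy
  isPath := by
    classical
    rw [← p.bypass_eq_self_of_length_le_length_bypass
      (hmin p.bypass hxy hx hy fun v hv => hX v (p.support_bypass_subset_support hv))]
    exact p.bypass_isPath
  induced := by
    have key : ∀ i j, i < j → j ≤ p.length → G.Adj (p.getVert i) (p.getVert j) →
        p.toSubgraph.Adj (p.getVert i) (p.getVert j) := by
      intro i j hij hj hadj
      have hle := hmin ((p.take i).append (Walk.cons hadj (p.drop j))) hxy hx hy (by
        intro v hv
        rw [Walk.mem_support_append_iff, Walk.support_cons, List.mem_cons] at hv
        rcases hv with hv | rfl | hv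
        · exact hX v ((p.isSubwalk_take i).support_subset hv)
        · exact hX _ (p.getVert_mem_support i)
        · exact hX v ((p.isSubwalk_drop j).support_subset hv))
      simp only [Walk.length_append, Walk.length_cons, Walk.take_length, Walk.drop_length] at hle
      obtain rfl : j = i + 1 := by omega
      exact p.toSubgraph_adj_getVert (by omega)
    intro u v hu hv huv
    obtain ⟨i, rfl, hi⟩ := Walk.mem_support_iff_exists_getVert.1 hu
    obtain ⟨j, rfl, hj⟩ := Walk.mem_support_iff_exists_getVert.1 hv
    rcases lt_trichotomy i j with h | rfl | h
    · exact key i j h hj huv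
    · exact (G.loopless.irrefl _ huv).elim
    · exact (key j i h hi huv.symm).symm
  support_mem _ _ := trivial
  fst_mem := hx
  snd_mem := hy
  interior v hv hvx hvy hvS := by
    classical
    have hle := hmin (p.takeUntil v hv) hvx.symm hx hvS
      fun w hw => hX w (p.support_takeUntil_subset_support hv hw)
    exact (p.length_takeUntil_lt_length hv hvy).not_ge hle

/-- If a component of `X` contains two vertices of `S`, then `X` contains a route. -/
theorem exists_isRoute_of_one_lt_ncard {V : Type} {G : SimpleGraph V} {X S L : Set V}
    (hL : L ∈ CompsOn G X) (hcard : 1 < (L ∩ S).ncard) :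
    ∃ (x y : V) (p : G.Walk x y), IsRoute G Set.univ S p ∧ ∀ v ∈ p.support, v ∈ X := by
  obtain ⟨C, rfl⟩ := hL
  obtain ⟨_, ⟨⟨a, ha, rfl⟩, haS⟩, _, ⟨⟨b, hb, rfl⟩, hbS⟩, hab⟩ :=
    (Set.one_lt_ncard (Set.finite_of_ncard_pos (by omega))).1 hcard
  obtain ⟨w⟩ := C.reachable_of_mem_supp ha hb
  let P : ℕ → Prop := fun n => ∃ (x y : V) (p : G.Walk x y), p.length = n ∧ x ≠ y ∧
    x ∈ S ∧ y ∈ S ∧ ∀ v ∈ p.support, v ∈ X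
  have hP : ∃ n, P n := by
    refine ⟨_, a, b, w.map (Embedding.induce X).toHom, rfl, hab, haS, hbS, fun v hv => ?_⟩
    obtain ⟨u, -, rfl⟩ := List.mem_map.1
      ((congrArg (v ∈ ·) (w.support_map (Embedding.induce X).toHom)).mp hv)
    exact u.2
  classical
  obtain ⟨x, y, p, hp, hxy, hx, hy, hX⟩ := Nat.find_spec hP
  refine ⟨x, y, p, isRoute_of_forall_length_le p hxy hx hy hX ?_, hX⟩
  intro c d q hcd hc hd hq
  rw [hp]
  exact Nat.find_min' hP ⟨c, d, q, rfl, hcd, hc, hd, hq⟩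

/-- A route can be oriented so that an injective labelling increases from its first end
to its last. -/
theorem exists_isRoute_lt {V : Type} {G : SimpleGraph V} {X S L : Set V} {f : V → ℕ}
    (hf : Set.InjOn f S) (hL : L ∈ CompsOn G X) (hcard : 1 < (L ∩ S).ncard) :
    ∃ (x y : V) (p : G.Walk x y), f x < f y ∧ IsRoute G Set.univ S p ∧
      ∀ v ∈ p.support, v ∈ X := by
  obtain ⟨x, y, p, hp, hX⟩ := exists_isRoute_of_one_lt_ncard hL hcard
  rcases lt_or_gt_of_ne (hf.ne hp.fst_mem hp.snd_mem hp.ne) with h | h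
  · exact ⟨x, y, p, h, hp, hX⟩
  · exact ⟨y, x, p.reverse, h, hp.reverse, by simpa using hX⟩

/-- Lemma 8.2: in an ample interrupted constellation, for every two
anticomplete induced subgraphs `X₁, X₂`, one of them has all its components meeting
the stable set in at most one vertex. -/
theorem stmt15 {V : Type} [Fintype V] (G : SimpleGraph V) (S : Set V)
    (hc : IsConstellationOn G Set.univ S)
    (ha : DAmple G Set.univ S 1)
    (hi : Interrupted G Set.univ S) :
    ∀ X₁ X₂ : Set V, Anticomplete G X₁ X₂ →
      (∀ L ∈ CompsOn G X₁, (L ∩ S).ncard ≤ 1) ∨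
      (∀ L ∈ CompsOn G X₂, (L ∩ S).ncard ≤ 1) := by
  intro X₁ X₂ hX
  by_contra! h
  obtain ⟨⟨L₁, hL₁, h₁⟩, L₂, hL₂, h₂⟩ := h
  obtain ⟨f, hf, hint⟩ := hi
  obtain ⟨x₁, y₁, p₁, hlt₁, hp₁, hs₁⟩ := exists_isRoute_lt hf hL₁ h₁
  obtain ⟨x₂, y₂, p₂, hlt₂, hp₂, hs₂⟩ := exists_isRoute_lt hf hL₂ h₂
  have hy₁ := hs₁ _ p₁.end_mem_support
  have hy₂ := hs₂ _ p₂.end_mem_support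
  have hne : f y₁ ≠ f y₂ := hf.ne hp₁.snd_mem hp₂.snd_mem (hX.1.ne_of_mem hy₁ hy₂)
  rcases lt_or_gt_of_ne hne with h | h
  · obtain ⟨v, hv, hadj⟩ :=
      hint _ hp₁.fst_mem _ hp₁.snd_mem _ hp₂.snd_mem hlt₁ h p₁ hp₁
    exact hX.2 v (hs₁ v hv) _ hy₂ hadj.symm
  · obtain ⟨v, hv, hadj⟩ :=
      hint _ hp₂.fst_mem _ hp₂.snd_mem _ hp₁.snd_mem hlt₂ h p₂ hp₂
    exact hX.2 _ hy₁ v (hs₂ v hv) hadj
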